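/- Two-cliques case: Let S₁ and S₂ be two triplets of points in the plane, each equipped with wedges of angle 2π/3 oriented by the gadget construction, and suppose additionally that within each triplet every pair of points is mutually covered (both induced graphs are triangles/cliques). Then there exist p ∈ S₁ and q ∈ S₂ with p ∈ W_q and q ∈ W_p; i.e., the induced graph on S₁ ∪ S₂ is connected. -/

import Mathlib

open Real

noncomputable section

abbrev Pl := EuclideanSpace ℝ (Fin 2)

def pt (x y : ℝ) : Pl := (EuclideanSpace.equiv (Fin 2) ℝ).symm ![x, y]

def dir (θ : ℝ) : Pl := pt (Real.cos θ) (Real.sin θ)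

/-- Wedge with apex `p`, bisector orientation `θ`, angular width `α`. -/
def wedge (p : Pl) (θ α : ℝ) : Set Pl :=
  {q | q = p ∨ InnerProductGeometry.angle (q - p) (dir θ) ≤ α / 2}

end

open EuclideanGeometry in
/-- The gadget orientation of Claim 1: the triplet `a b c` is labelled so that
the triangle angles satisfy `∠b ≤ ∠c ≤ ∠a`; in a frame rotated by `φ` the
segment `bc` is horizontal with `b` left of `c` and `a` on or above the line
through `bc`; the bisector orientations of the 2π/3-wedges at `a`, `b`, `c` are
240°, 0°, 120° in that frame. -/
def gadget (a b c : Pl) (θa θb θc : ℝ) : Prop :=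
  AffineIndependent ℝ ![a, b, c] ∧
  ∠ a b c ≤ ∠ b c a ∧ ∠ b c a ≤ ∠ c a b ∧
  ∃ φ : ℝ, c - b = ‖c - b‖ • dir φ ∧
    0 ≤ (a - b) 0 * dir (φ + π / 2) 0 + (a - b) 1 * dir (φ + π / 2) 1 ∧
    θb = φ ∧ θc = φ + 2 * π / 3 ∧ θa = φ + 4 * π / 3

/-- The signed distance of `v` from the line through the origin with orientation `t`, positive on
the left of the line. -/
noncomputable def side (t : ℝ) (v : Pl) : ℝ := Real.cos t * v 1 - Real.sin t * v 0

lemma dir_zero (t : ℝ) : dir t 0 = Real.cos t := by simp [dir, pt]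

lemma dir_one (t : ℝ) : dir t 1 = Real.sin t := by simp [dir, pt]

lemma norm_dir (t : ℝ) : ‖dir t‖ = 1 := by
  simp [EuclideanSpace.norm_eq, Fin.sum_univ_two, dir_zero, dir_one]

lemma dir_add_int_mul_two_pi (t : ℝ) (n : ℤ) : dir (t + n * (2 * π)) = dir t := by
  simp only [dir, Real.cos_add_int_mul_two_pi, Real.sin_add_int_mul_two_pi]

lemma side_sub_two_pi (t : ℝ) (v : Pl) : side (t - 2 * π) v = side t v := by
  simp only [side, Real.cos_sub_two_pi, Real.sin_sub_two_pi]

/-- Addition formula for `side`. -/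
lemma side_add (t d : ℝ) (v : Pl) :
    side (t + d) v =
      Real.cos d * side t v - Real.sin d * (Real.cos t * v 0 + Real.sin t * v 1) := by
  simp only [side, Real.cos_add, Real.sin_add]; ring

lemma side_sub (t : ℝ) (v w : Pl) : side t (v - w) = side t v - side t w := by
  simp only [side, PiLp.sub_apply]; ring

lemma angle_dir_le_iff (v : Pl) (hv : v ≠ 0) (t : ℝ) :
    InnerProductGeometry.angle v (dir t) ≤ π / 3 ↔
      0 ≤ side (t - π / 3) v ∧ side (t + π / 3) v ≤ 0 := by
  have hn : 0 < ‖v‖ := norm_pos_iff.mpr hv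
  have h3 : (√3 : ℝ) ^ 2 = 3 := Real.sq_sqrt (by norm_num)
  have h3p : 0 < (√3 : ℝ) := by positivity
  set c := Real.cos t * v 0 + Real.sin t * v 1 with hc
  set s := side t v with hs
  have hin : inner ℝ v (dir t) = c := by
    simp [PiLp.inner_apply, Fin.sum_univ_two, dir_zero, dir_one, hc]
  have hsq : ‖v‖ ^ 2 = c ^ 2 + s ^ 2 := by
    rw [EuclideanSpace.norm_sq_eq, Fin.sum_univ_two, Real.norm_eq_abs, Real.norm_eq_abs, sq_abs,
      sq_abs, hc, hs, side]
    linear_combination (-(v 0) ^ 2 - (v 1) ^ 2) * Real.sin_sq_add_cos_sq t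
  have hl : side (t - π / 3) v = 1 / 2 * s + √3 / 2 * c := by
    rw [sub_eq_add_neg, side_add, Real.cos_neg, Real.sin_neg, Real.cos_pi_div_three,
      Real.sin_pi_div_three, ← hc, ← hs]
    ring
  have hr : side (t + π / 3) v = 1 / 2 * s - √3 / 2 * c := by
    rw [side_add, Real.cos_pi_div_three, Real.sin_pi_div_three, ← hc, ← hs]
  have hcos : InnerProductGeometry.angle v (dir t) ≤ π / 3 ↔ ‖v‖ ≤ 2 * c := by
    rw [← Real.strictAntiOn_cos.le_iff_ge ⟨by positivity, by linarith [Real.pi_pos]⟩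
      ⟨InnerProductGeometry.angle_nonneg _ _, InnerProductGeometry.angle_le_pi _ _⟩,
      InnerProductGeometry.cos_angle, hin, norm_dir, mul_one, Real.cos_pi_div_three,
      le_div_iff₀ hn]
    constructor <;> intro h <;> linarith
  rw [hcos, hl, hr]
  constructor
  · intro h
    have h1 : |s| ≤ √3 * c := by
      apply abs_le_of_sq_le_sq _ (by nlinarith)
      rw [mul_pow, h3]
      nlinarith
    constructor <;> linarith [abs_le.mp h1]
  · rintro ⟨h1, h2⟩
    have h4 : 0 ≤ √3 * c := by linarith
    have h5 : 0 ≤ c := nonneg_of_mul_nonneg_right h4 h3p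
    have h6 : s ^ 2 ≤ (√3 * c) ^ 2 := sq_le_sq' (by linarith) (by linarith)
    rw [mul_pow, h3] at h6
    exact le_of_sq_le_sq (by nlinarith) (by positivity)

lemma mem_wedge_iff (p q : Pl) (t : ℝ) :
    q ∈ wedge p t (2 * π / 3) ↔
      side (t - π / 3) p ≤ side (t - π / 3) q ∧ side (t + π / 3) q ≤ side (t + π / 3) p := by
  rw [wedge, Set.mem_ofPred_eq, show 2 * π / 3 / 2 = π / 3 by ring]
  by_cases h : q = p
  · simp [h]
  · rw [angle_dir_le_iff _ (sub_ne_zero.mpr h), side_sub, side_sub, sub_nonneg, sub_nonpos]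
    simp [h]

lemma mem_wedge_iff_zero (p q : Pl) (t : ℝ) :
    q ∈ wedge p (t + (0 : ℤ) * (2 * π / 3)) (2 * π / 3) ↔
      side (t - π / 3) p ≤ side (t - π / 3) q ∧ side (t + π / 3) q ≤ side (t + π / 3) p := by
  rw [mem_wedge_iff, Int.cast_zero, zero_mul, add_zero]

lemma mem_wedge_iff_one (p q : Pl) (t : ℝ) :
    q ∈ wedge p (t + (1 : ℤ) * (2 * π / 3)) (2 * π / 3) ↔
      side (t + π / 3) p ≤ side (t + π / 3) q ∧ side (t + π) q ≤ side (t + π) p := by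
  rw [mem_wedge_iff, Int.cast_one, show t + 1 * (2 * π / 3) - π / 3 = t + π / 3 by ring,
    show t + 1 * (2 * π / 3) + π / 3 = t + π by ring]

lemma mem_wedge_iff_two (p q : Pl) (t : ℝ) :
    q ∈ wedge p (t + (2 : ℤ) * (2 * π / 3)) (2 * π / 3) ↔
      side (t + π) p ≤ side (t + π) q ∧ side (t - π / 3) q ≤ side (t - π / 3) p := by
  rw [mem_wedge_iff, Int.cast_ofNat, show t + 2 * (2 * π / 3) - π / 3 = t + π by ring,
    ← side_sub_two_pi (t + 2 * (2 * π / 3) + π / 3),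
    ← side_sub_two_pi (t + 2 * (2 * π / 3) + π / 3),
    show t + 2 * (2 * π / 3) + π / 3 - 2 * π = t - π / 3 by ring]

/-- The boundary functionals of a triplet, rotated by `d`, in terms of the original ones. -/
lemma side_rotate (t d : ℝ) (v : Pl) :
    let α := Real.cos d + Real.sin d / √3
    let β := 2 * Real.sin d / √3
    side (t + d + π / 3) v = α * side (t + π / 3) v + β * side (t + π) v ∧
    side (t + d + π) v = α * side (t + π) v + β * side (t - π / 3) v ∧
    side (t + d - π / 3) v = α * side (t - π / 3) v + β * side (t + π / 3) v := by
  have h3 : (√3 : ℝ) ^ 2 = 3 := Real.sq_sqrt (by norm_num)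
  have h3p : (√3 : ℝ) ≠ 0 := by positivity
  intro α β
  simp only [α, β, sub_eq_add_neg, add_assoc, side_add t]
  simp only [Real.cos_add, Real.sin_add, Real.cos_neg, Real.sin_neg, Real.cos_pi, Real.sin_pi,
    Real.cos_pi_div_three, Real.sin_pi_div_three]
  generalize side t v = s
  generalize Real.cos t * v 0 + Real.sin t * v 1 = c
  generalize (√3 : ℝ) = r at *
  refine ⟨?_, ?_, ?_⟩ <;> field_simp <;> grind

section Combinatorial

variable {a b c α β : ℝ}

lemma next_wedge_conditions (hs : a + b + c = 0) (hβ : 0 ≤ β) (hβα : β ≤ α)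
    (hn : α ^ 2 + β ^ 2 - α * β = 1) (hc : 0 ≤ c) (hb : 0 ≤ α * b + β * c) :
    a ≤ 0 ∧ α * a + β * b ≤ 0 := by
  have hα : 0 < α := by nlinarith
  obtain rfl : a = -b - c := by linarith
  constructor
  · by_contra! h
    nlinarith [mul_pos hα h, mul_nonneg (sub_nonneg.mpr hβα) hc]
  · by_contra! h
    nlinarith [mul_pos hα h, mul_nonneg (sub_nonneg.mpr hβα) hb]

lemma previous_wedge_conditions (hs : a + b + c = 0) (hβ : 0 ≤ β) (hβα : β < α)
    (hn : α ^ 2 + β ^ 2 - α * β = 1) (ha : a ≤ 0) (hb : α * b + β * c ≤ 0) :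
    0 ≤ c ∧ 0 ≤ α * c + β * a := by
  have hα : 0 < α := by linarith
  obtain rfl : b = -a - c := by linarith
  have hd : 0 < α - β := by linarith
  constructor
  · by_contra! h
    nlinarith [mul_pos hd (neg_pos.mpr h), mul_nonneg hα.le (neg_nonneg.mpr ha)]
  · by_contra! h
    nlinarith [mul_pos hd (neg_pos.mpr h), mul_nonneg hα.le (neg_nonneg.mpr hb)]

variable {X : Type*} {A B C A' B' C' : X → ℝ} {p₀ p₁ p₂ q₀ q₁ q₂ : X}

lemma next_alternative (hs : ∀ x, A x + B x + C x = 0) (hA' : ∀ x, A' x = α * A x + β * B x)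
    (hB' : ∀ x, B' x = α * B x + β * C x) (hβ : 0 ≤ β) (hβα : β ≤ α)
    (hn : α ^ 2 + β ^ 2 - α * β = 1)
    (h : ¬((A' q₁ ≤ A' p₀ ∧ B' p₀ ≤ B' q₁) ∧ C p₀ ≤ C q₁ ∧ A q₁ ≤ A p₀)) :
    C q₁ < C p₀ ∨ B' q₁ < B' p₀ := by
  by_contra! hc
  obtain ⟨h1, h2⟩ := next_wedge_conditions (a := A q₁ - A p₀) (b := B q₁ - B p₀)
    (c := C q₁ - C p₀) (by linarith [hs p₀, hs q₁]) hβ hβα hn (by linarith)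
    (by linarith [hB' p₀, hB' q₁])
  exact h ⟨⟨by linarith [hA' p₀, hA' q₁], hc.2⟩, hc.1, by linarith⟩

lemma previous_alternative (hs : ∀ x, A x + B x + C x = 0)
    (hA' : ∀ x, A' x = α * A x + β * B x) (hB' : ∀ x, B' x = α * B x + β * C x)
    (hC' : ∀ x, C' x = α * C x + β * A x) (hβ : 0 ≤ β) (hβα : β ≤ α)
    (hn : α ^ 2 + β ^ 2 - α * β = 1)
    (hB : B p₂ ≤ B p₀) (hC : C p₀ ≤ C p₂) (hA'q : A' q₂ ≤ A' q₀) (hC'q : C' q₀ ≤ C' q₂)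
    (hnext : B q₀ < B p₂ ∨ A' q₀ < A' p₂)
    (h : ¬((B' q₂ ≤ B' p₀ ∧ C' p₀ ≤ C' q₂) ∧ C p₀ ≤ C q₂ ∧ A q₂ ≤ A p₀)) :
    A p₀ < A q₂ ∨ B' p₀ < B' q₂ := by
  by_contra! hc
  rcases hβα.lt_or_eq with hlt | rfl
  · obtain ⟨h1, h2⟩ := previous_wedge_conditions (a := A q₂ - A p₀) (b := B q₂ - B p₀)
      (c := C q₂ - C p₀) (by linarith [hs p₀, hs q₂]) hβ hlt hn (by linarith)
      (by linarith [hB' p₀, hB' q₂])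
    exact h ⟨⟨hc.2, by linarith [hC' p₀, hC' q₂]⟩, by linarith, hc.1⟩
  · obtain rfl : β = 1 := by nlinarith
    refine h ⟨⟨hc.2, ?_⟩, ?_, hc.1⟩ <;> by_contra! hlt <;> rcases hnext with h4 | h4 <;>
      linarith [hs p₀, hs p₂, hs q₀, hs q₂, hA' p₂, hA' q₀, hA' q₂, hB' p₀, hB' q₂, hC' p₀,
        hC' q₀, hC' q₂]

/-- Abstract form of the two-cliques case: the wedge of `pᵢ` is bounded by two of the functionals
`A`, `B`, `C`, the wedge of `qⱼ` by two of their rotations `A'`, `B'`, `C'`. If no `pᵢ`, `qⱼ`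
with `i ≠ j` are mutually covered, a contradiction follows. -/
lemma false_of_no_mutual_pair (hs : ∀ x, A x + B x + C x = 0)
    (hA' : ∀ x, A' x = α * A x + β * B x) (hB' : ∀ x, B' x = α * B x + β * C x)
    (hC' : ∀ x, C' x = α * C x + β * A x) (hβ : 0 ≤ β) (hβα : β ≤ α)
    (hn : α ^ 2 + β ^ 2 - α * β = 1)
    (hA₁₂ : A p₁ ≤ A p₂) (hA₂₀ : A p₂ ≤ A p₀) (hB₂₀ : B p₂ ≤ B p₀) (hB₀₁ : B p₀ ≤ B p₁)
    (hC₀₁ : C p₀ ≤ C p₁) (hC₁₂ : C p₁ ≤ C p₂)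
    (hA'₁₂ : A' q₁ ≤ A' q₂) (hA'₂₀ : A' q₂ ≤ A' q₀) (hB'₂₀ : B' q₂ ≤ B' q₀)
    (hB'₀₁ : B' q₀ ≤ B' q₁) (hC'₀₁ : C' q₀ ≤ C' q₁) (hC'₁₂ : C' q₁ ≤ C' q₂)
    (h₀₁ : ¬((A' q₁ ≤ A' p₀ ∧ B' p₀ ≤ B' q₁) ∧ C p₀ ≤ C q₁ ∧ A q₁ ≤ A p₀))
    (h₁₂ : ¬((B' q₂ ≤ B' p₁ ∧ C' p₁ ≤ C' q₂) ∧ A p₁ ≤ A q₂ ∧ B q₂ ≤ B p₁))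
    (h₂₀ : ¬((C' q₀ ≤ C' p₂ ∧ A' p₂ ≤ A' q₀) ∧ B p₂ ≤ B q₀ ∧ C q₀ ≤ C p₂))
    (h₀₂ : ¬((B' q₂ ≤ B' p₀ ∧ C' p₀ ≤ C' q₂) ∧ C p₀ ≤ C q₂ ∧ A q₂ ≤ A p₀))
    (h₁₀ : ¬((C' q₀ ≤ C' p₁ ∧ A' p₁ ≤ A' q₀) ∧ A p₁ ≤ A q₀ ∧ B q₀ ≤ B p₁))
    (h₂₁ : ¬((A' q₁ ≤ A' p₂ ∧ B' p₂ ≤ B' q₁) ∧ B p₂ ≤ B q₁ ∧ C q₁ ≤ C p₂)) : False := by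
  have hsB : ∀ x, B x + C x + A x = 0 := fun x => by linarith [hs x]
  have hsC : ∀ x, C x + A x + B x = 0 := fun x => by linarith [hs x]
  have f₀₁ := next_alternative hs hA' hB' hβ hβα hn h₀₁
  have f₁₂ := next_alternative hsB hB' hC' hβ hβα hn h₁₂
  have f₂₀ := next_alternative hsC hC' hA' hβ hβα hn h₂₀
  have f₀₂ := previous_alternative hs hA' hB' hC' hβ hβα hn hB₂₀ (hC₀₁.trans hC₁₂) hA'₂₀
    (hC'₀₁.trans hC'₁₂) f₂₀ h₀₂
  have f₁₀ := previous_alternative hsB hB' hC' hA' hβ hβα hn hC₀₁ (hA₁₂.trans hA₂₀) hB'₀₁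
    (hA'₁₂.trans hA'₂₀) f₀₁ h₁₀
  have f₂₁ := previous_alternative hsC hC' hA' hB' hβ hβα hn hA₁₂ (hB₂₀.trans hB₀₁) hC'₁₂
    (hB'₂₀.trans hB'₀₁) f₁₂ h₂₁
  have hα : 0 < α := by nlinarith
  rcases f₀₁ with f₀₁ | f₀₁
  · have f₂₁ : A' p₂ < A' q₁ := f₂₁.resolve_left (by linarith)
    have f₂₀ : B q₀ < B p₂ := f₂₀.resolve_right (by linarith)
    have f₁₀ : C' p₁ < C' q₀ := f₁₀.resolve_left (by linarith)
    have f₁₂ : A q₂ < A p₁ := f₁₂.resolve_right (by linarith)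
    have f₀₂ : B' p₀ < B' q₂ := f₀₂.resolve_left (by linarith)
    have hβC : 0 < β * (C q₀ - C p₀) := by
      nlinarith [hB' p₀, hB' q₀]
    have hC : 0 < C q₀ - C p₀ := pos_of_mul_pos_right hβC hβ
    have inv : ∀ x, C x = α * C' x + β * B' x := fun x => by
      rw [hC', hB']
      linear_combination -C x * hn - α * β * hs x
    nlinarith [inv q₀, inv q₁]
  · have f₀₂ : A p₀ < A q₂ := f₀₂.resolve_right (by linarith)
    have f₁₂ : C' q₂ < C' p₁ := f₁₂.resolve_left (by linarith)
    have f₁₀ : B p₁ < B q₀ := f₁₀.resolve_right (by linarith)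
    have f₂₀ : A' q₀ < A' p₂ := f₂₀.resolve_left (by linarith)
    have inv : ∀ x, B x = α * B' x + β * A' x := fun x => by
      rw [hB', hA']
      linear_combination -B x * hn - α * β * hs x
    have hβA : 0 < β * (A' q₀ - A' p₀) := by
      nlinarith [inv p₀, inv q₀]
    have hA : 0 < A' q₀ - A' p₀ := pos_of_mul_pos_right hβA hβ
    nlinarith [hA' p₀, hA' p₂]

end Combinatorial

/-- A triplet with wedges of angle `2π/3` whose bisector orientations are `t`, `t + 2π/3`,
`t + 4π/3`, extended to a `3`-periodic family, in which all pairs are mutually covered. -/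
def IsCliqueFamily (P : ℤ → Pl) (t : ℝ) : Prop :=
  ∀ i j : ℤ, P j ∈ wedge (P i) (t + i * (2 * π / 3)) (2 * π / 3)

lemma IsCliqueFamily.exists_mutual_of_le {P Q : ℤ → Pl} {t d : ℝ} (hP : IsCliqueFamily P t)
    (hQ : IsCliqueFamily Q (t + d)) (hd0 : 0 ≤ d) (hd : d ≤ π / 3) :
    ∃ i j : ℤ, P i ∈ wedge (Q j) (t + d + j * (2 * π / 3)) (2 * π / 3) ∧
      Q j ∈ wedge (P i) (t + i * (2 * π / 3)) (2 * π / 3) := by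
  by_contra! hno
  have h3 : (√3 : ℝ) ^ 2 = 3 := Real.sq_sqrt (by norm_num)
  have h3p : 0 < (√3 : ℝ) := by positivity
  have hsin : 0 ≤ Real.sin d := Real.sin_nonneg_of_nonneg_of_le_pi hd0 (by linarith [Real.pi_pos])
  have hdiff : 0 ≤ Real.sin (π / 3 - d) :=
    Real.sin_nonneg_of_nonneg_of_le_pi (by linarith) (by linarith [Real.pi_pos])
  rw [Real.sin_sub, Real.sin_pi_div_three, Real.cos_pi_div_three] at hdiff
  have p₀ := fun j => (mem_wedge_iff_zero _ _ _).mp (hP 0 j)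
  have p₁ := fun j => (mem_wedge_iff_one _ _ _).mp (hP 1 j)
  have p₂ := fun j => (mem_wedge_iff_two _ _ _).mp (hP 2 j)
  have q₀ := fun j => (mem_wedge_iff_zero _ _ _).mp (hQ 0 j)
  have q₁ := fun j => (mem_wedge_iff_one _ _ _).mp (hQ 1 j)
  have q₂ := fun j => (mem_wedge_iff_two _ _ _).mp (hQ 2 j)
  have n := fun i j => not_and.mpr (hno i j)
  have n₀₁ := n 0 1
  have n₁₂ := n 1 2
  have n₂₀ := n 2 0
  have n₀₂ := n 0 2
  have n₁₀ := n 1 0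
  have n₂₁ := n 2 1
  simp only [mem_wedge_iff_zero, mem_wedge_iff_one, mem_wedge_iff_two] at n₀₁ n₁₂ n₂₀ n₀₂ n₁₀ n₂₁
  refine false_of_no_mutual_pair (A := side (t + π / 3)) (B := side (t + π))
    (C := side (t - π / 3)) (α := Real.cos d + Real.sin d / √3) (β := 2 * Real.sin d / √3)
    ?_ (fun v => (side_rotate t d v).1) (fun v => (side_rotate t d v).2.1)
    (fun v => (side_rotate t d v).2.2) (by positivity) ?_ ?_
    (p₁ 2).1 (p₀ 2).2 (p₂ 0).1 (p₁ 0).2 (p₀ 1).1 (p₂ 1).2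
    (q₁ 2).1 (q₀ 2).2 (q₂ 0).1 (q₁ 0).2 (q₀ 1).1 (q₂ 1).2
    n₀₁ n₁₂ n₂₀ n₀₂ n₁₀ n₂₁
  · intro v
    rw [sub_eq_add_neg, side_add, side_add, side_add, Real.cos_neg, Real.sin_neg, Real.cos_pi,
      Real.sin_pi, Real.cos_pi_div_three, Real.sin_pi_div_three]
    ring
  · rw [← sub_nonneg]
    have : Real.cos d + Real.sin d / √3 - 2 * Real.sin d / √3 =
        2 / √3 * (√3 / 2 * Real.cos d - 1 / 2 * Real.sin d) := by
      field_simp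
      ring
    rw [this]
    positivity
  · have hcs := Real.sin_sq_add_cos_sq d
    field_simp
    grind

lemma IsCliqueFamily.shift {P : ℤ → Pl} {t : ℝ} (hP : IsCliqueFamily P t) (k : ℤ) :
    IsCliqueFamily (fun i => P (i + k)) (t + k * (2 * π / 3)) := by
  intro i j
  convert hP (i + k) (j + k) using 1
  push_cast
  congr 1
  ring

lemma IsCliqueFamily.exists_mutual {P Q : ℤ → Pl} {t u : ℝ} (hP : IsCliqueFamily P t)
    (hQ : IsCliqueFamily Q u) :
    ∃ i j : ℤ, P i ∈ wedge (Q j) (u + j * (2 * π / 3)) (2 * π / 3) ∧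
      Q j ∈ wedge (P i) (t + i * (2 * π / 3)) (2 * π / 3) := by
  have hpi := Real.pi_pos
  obtain ⟨k, hk⟩ : ∃ k : ℤ, |t - u - k * (2 * π / 3)| ≤ π / 3 := by
    refine ⟨round ((t - u) / (2 * π / 3)), ?_⟩
    have h := abs_sub_round ((t - u) / (2 * π / 3))
    generalize round ((t - u) / (2 * π / 3)) = k at h ⊢
    have he : t - u - k * (2 * π / 3) = ((t - u) / (2 * π / 3) - k) * (2 * π / 3) := by
      field_simp
    rw [he, abs_mul, abs_of_pos (by positivity : 0 < 2 * π / 3)]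
    nlinarith
  have hQk := hQ.shift k
  have hcast : ∀ j : ℤ, u + k * (2 * π / 3) + j * (2 * π / 3) = u + (j + k : ℤ) * (2 * π / 3) := by
    intro j
    push_cast
    ring
  obtain ⟨h1, h2⟩ := abs_le.mp hk
  rcases le_total (u + k * (2 * π / 3)) t with h | h
  · obtain ⟨d, rfl⟩ : ∃ d, t = u + k * (2 * π / 3) + d := ⟨_, (add_sub_cancel _ _).symm⟩
    obtain ⟨i, j, hij, hji⟩ := hQk.exists_mutual_of_le hP (by linarith) (by linarith)
    rw [hcast] at hji
    exact ⟨j, i + k, hji, hij⟩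
  · obtain ⟨d, hd⟩ : ∃ d, u + k * (2 * π / 3) = t + d := ⟨_, (add_sub_cancel _ _).symm⟩
    rw [hd] at hQk
    obtain ⟨i, j, hij, hji⟩ := hP.exists_mutual_of_le hQk (by linarith) (by linarith)
    rw [← hd, hcast] at hij
    exact ⟨i, j + k, hij, hji⟩

/-- A triplet oriented by the gadget construction extends to a `3`-periodic family. -/
lemma gadget.exists_family {a b c : Pl} {θ : Pl → ℝ} (h : gadget a b c (θ a) (θ b) (θ c)) :
    ∃ (P : ℤ → Pl) (t : ℝ), ∀ i, P i ∈ ({a, b, c} : Set Pl) ∧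
      wedge (P i) (t + i * (2 * π / 3)) (2 * π / 3) = wedge (P i) (θ (P i)) (2 * π / 3) := by
  obtain ⟨-, -, -, t, -, -, hb, hc, ha⟩ := h
  refine ⟨fun i => if i % 3 = 0 then b else if i % 3 = 1 then c else a, t, fun i => ?_⟩
  have key : ∀ (r : ℤ) (p : Pl), i % 3 = r → θ p = t + r * (2 * π / 3) →
      wedge p (t + i * (2 * π / 3)) (2 * π / 3) = wedge p (θ p) (2 * π / 3) := by
    intro r p hr hp
    have hi : (i : ℝ) = r + 3 * (i / 3 : ℤ) := by
      exact_mod_cast (by omega : i = r + 3 * (i / 3))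
    have ht : t + i * (2 * π / 3) = θ p + (i / 3 : ℤ) * (2 * π) := by
      rw [hp, hi]
      ring
    rw [ht, wedge, wedge, dir_add_int_mul_two_pi]
  have hmod : i % 3 = 0 ∨ i % 3 = 1 ∨ i % 3 = 2 := by omega
  rcases hmod with hr | hr | hr
  · simpa [hr] using key 0 b hr (by rw [hb]; simp)
  · simpa [hr] using key 1 c hr (by rw [hc]; push_cast; ring)
  · simpa [hr] using key 2 a hr (by rw [ha]; push_cast; ring)

/-- Two-cliques case: if the 2π/3-wedges of two triplets are oriented by the
gadget construction and within each triplet every pair of points is mutually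
covered (both induced graphs are cliques), then some point of the first triplet
and some point of the second are mutually covered. -/
theorem stmt19 (a b c x y z : Pl)
    (θ : Pl → ℝ)
    (h₁ : gadget a b c (θ a) (θ b) (θ c))
    (h₂ : gadget x y z (θ x) (θ y) (θ z))
    (hclique₁ : ∀ p ∈ ({a, b, c} : Set Pl), ∀ q ∈ ({a, b, c} : Set Pl),
      p ∈ wedge q (θ q) (2 * π / 3) ∧ q ∈ wedge p (θ p) (2 * π / 3))
    (hclique₂ : ∀ p ∈ ({x, y, z} : Set Pl), ∀ q ∈ ({x, y, z} : Set Pl),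
      p ∈ wedge q (θ q) (2 * π / 3) ∧ q ∈ wedge p (θ p) (2 * π / 3)) :
    ∃ p ∈ ({a, b, c} : Set Pl), ∃ q ∈ ({x, y, z} : Set Pl),
      p ∈ wedge q (θ q) (2 * π / 3) ∧ q ∈ wedge p (θ p) (2 * π / 3) := by
  obtain ⟨P, t, hP⟩ := h₁.exists_family
  obtain ⟨Q, u, hQ⟩ := h₂.exists_family
  have hPc : IsCliqueFamily P t := fun i j => by
    rw [(hP i).2]
    exact (hclique₁ _ (hP j).1 _ (hP i).1).1
  have hQc : IsCliqueFamily Q u := fun i j => by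
    rw [(hQ i).2]
    exact (hclique₂ _ (hQ j).1 _ (hQ i).1).1
  obtain ⟨i, j, hij, hji⟩ := hPc.exists_mutual hQc
  rw [(hQ j).2] at hij
  rw [(hP i).2] at hji
  exact ⟨P i, (hP i).1, Q j, (hQ j).1, hij, hji⟩
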